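/- arXiv:2512.06588 — 3 statements merged into one kernel-verified Lean document; each statement's English description precedes it below -/
import Mathlib

section
/- Let F be a finite field of odd characteristic with q elements and let K/F be a quadratic field extension. Let χ be a nontrivial multiplicative character of F and let ψ be a nontrivial additive character of F. Then ∑_{x ∈ Kˣ, Tr_{K/F}(x) ≠ 0} χ(N_{K/F}(x · (Tr_{K/F}(x))⁻¹)) = −(q − 1) · q^{−1} · (∑_{x ∈ Fˣ} χ(x) ψ(x))² · (∑_{z ∈ Fˣ} χ(z)⁻² ψ(z)), where Tr_{K/F}(x) is regarded as an element of K when forming x · (Tr_{K/F}(x))⁻¹. -/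
open Finset

section SumsOverSquares

variable {F : Type*} [Field F] [Fintype F]

/-- A sum over squares is a sum weighted by the number of square roots. -/
lemma sum_comp_sq [DecidableEq F] (hF : ringChar F ≠ 2) (f : F → ℂ) :
    ∑ b : F, f (b ^ 2) = ∑ u : F, ((quadraticChar F u : ℂ) + 1) * f u := by
  rw [← Finset.sum_fiberwise' univ (fun b : F => b ^ 2) f]
  refine sum_congr rfl fun u _ => ?_
  rw [sum_const, nsmul_eq_mul]
  congr 1
  have h := quadraticChar_card_sqrts hF u
  rw [Set.toFinset_ofPred] at h
  exact_mod_cast h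

/-- The squares and the multiples of the squares by a nonsquare together
cover every element of the field twice. -/
lemma sum_comp_mul_sq_add_sum_comp_sq [DecidableEq F] (hF : ringChar F ≠ 2) {d : F}
    (hd : ¬IsSquare d) (f : F → ℂ) :
    ∑ b : F, f (d * b ^ 2) + ∑ b : F, f (b ^ 2) = 2 * ∑ u : F, f u := by
  have hd0 : d ≠ 0 := fun h => hd (h ▸ IsSquare.zero)
  have hη : quadraticChar F d = -1 := quadraticChar_neg_one_iff_not_isSquare.2 hd
  have htwist : ∑ u : F, ((quadraticChar F u : ℂ) + 1) * f (d * u) =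
      ∑ u : F, (-(quadraticChar F u : ℂ) + 1) * f u := by
    rw [← Equiv.sum_comp (Equiv.mulLeft₀ d hd0) fun u => (-(quadraticChar F u : ℂ) + 1) * f u]
    refine sum_congr rfl fun u _ => ?_
    change _ = (-(quadraticChar F (d * u) : ℂ) + 1) * f (d * u)
    rw [map_mul, hη]
    push_cast
    ring
  rw [sum_comp_sq hF (fun u => f (d * u)), sum_comp_sq hF f, htwist, ← sum_add_distrib, mul_sum]
  exact sum_congr rfl fun u _ => by ring

/-- The diagonal Jacobi sum, after completing the square. -/
lemma jacobiSum_self_eq_sum_sq (hF : ringChar F ≠ 2) (χ : MulChar F ℂ) :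
    jacobiSum χ χ = ∑ c : F, χ (1 / 4 - c ^ 2) := by
  have h2 : (2 : F) ≠ 0 := Ring.two_ne_zero hF
  have h4 : (4 : F) ≠ 0 := by
    rw [show (4 : F) = 2 * 2 by norm_num]
    exact mul_ne_zero h2 h2
  rw [jacobiSum, ← Equiv.sum_comp (Equiv.addLeft (1 / 2 : F))]
  refine sum_congr rfl fun c _ => ?_
  rw [← map_mul, Equiv.coe_addLeft]
  congr 1
  field_simp
  ring

lemma sum_mulChar_sub_mul_sq [DecidableEq F] (hF : ringChar F ≠ 2) {d : F} (hd : ¬IsSquare d)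
    {χ : MulChar F ℂ} (hχ : χ ≠ 1) :
    ∑ b : F, χ (1 / 4 - d * b ^ 2) = -jacobiSum χ χ := by
  have h := sum_comp_mul_sq_add_sum_comp_sq hF hd (fun u => χ (1 / 4 - u))
  have hshift : ∑ u : F, χ (1 / 4 - u) = ∑ u : F, χ u :=
    Equiv.sum_comp (Equiv.subLeft (1 / 4 : F)) fun u => χ u
  rw [hshift, MulChar.sum_eq_zero_of_ne_one hχ,
    mul_zero, ← jacobiSum_self_eq_sum_sq hF] at h
  exact eq_neg_of_add_eq_zero_left h

/-- A formula for the diagonal Jacobi sum that also holds for quadratic characters. -/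
lemma jacobiSum_self_eq_gaussSum {χ : MulChar F ℂ} (hχ : χ ≠ 1) {ψ : AddChar F ℂ} (hψ : ψ ≠ 1) :
    jacobiSum χ χ =
      (Fintype.card F : ℂ)⁻¹ * gaussSum χ ψ ^ 2 * gaussSum (χ ^ 2)⁻¹ ψ := by
  have hprim := AddChar.IsPrimitive.of_ne_one hψ
  have hq : (Fintype.card F : ℂ) ≠ 0 := Nat.cast_ne_zero.2 Fintype.card_ne_zero
  have hinv (φ : MulChar F ℂ) (hφ : φ ≠ 1) :
      gaussSum φ ψ * gaussSum φ⁻¹ ψ = φ (-1) * Fintype.card F := by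
    rw [← mul_gaussSum_inv_eq_gaussSum φ⁻¹, mul_left_comm, gaussSum_mul_gaussSum_eq_card hφ hprim,
      MulChar.inv_apply', inv_neg_one]
  rcases eq_or_ne (χ ^ 2) 1 with h | h
  · have hself : χ⁻¹ = χ := inv_eq_of_mul_eq_one_right (by rw [← sq, h])
    have hg := hinv χ hχ
    have hJ := jacobiSum_nontrivial_inv hχ
    rw [hself] at hg hJ
    rw [h, inv_one, gaussSum_one_left hψ, hJ, sq, hg]
    field_simp
  · have hg := hinv (χ ^ 2) h
    have hJ := jacobiSum_mul_nontrivial (by rwa [← sq] : χ * χ ≠ 1) ψ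
    have hsign : (χ ^ 2) (-1) = 1 := by
      rw [MulChar.pow_apply' _ two_ne_zero, ← map_pow, neg_one_sq, map_one]
    rw [← sq, ← sq] at hJ
    rw [hsign, one_mul] at hg
    rw [← hJ, mul_assoc, mul_right_comm, hg, inv_mul_cancel_left₀ hq]

lemma sum_eq_sum_units_of_map_zero {L : Type*} [Field L] [Fintype L] [DecidableEq L]
    (f : L → ℂ) (h0 : f 0 = 0) : ∑ x : L, f x = ∑ x : Lˣ, f x := by
  rw [← Fintype.sum_subtype_add_sum_subtype (fun x : L => x ≠ 0) f,
    ← unitsEquivNeZero.sum_comp (fun x : {x : L // x ≠ 0} => f x)]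
  simp only [unitsEquivNeZero_apply_coe, add_eq_left]
  exact sum_eq_zero fun x _ => by rw [not_not.1 x.2, h0]

lemma gaussSum_eq_sum_units [DecidableEq F] (χ : MulChar F ℂ) (ψ : AddChar F ℂ) :
    gaussSum χ ψ = ∑ x : Fˣ, χ (x : F) * ψ (x : F) :=
  sum_eq_sum_units_of_map_zero (fun x => χ x * ψ x) (by simp [MulChar.map_zero])

end SumsOverSquares

section QuadraticExtension

variable {F K : Type*} [Field F] [Field K] [Algebra F K]

lemma trace_algebraMap_add_smul (hquad : Module.finrank F K = 2) {δ : K}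
    (hδ : Algebra.trace F K δ = 0) (a b : F) :
    Algebra.trace F K (algebraMap F K a + b • δ) = 2 * a := by
  rw [map_add, map_smul, hδ, Algebra.trace_algebraMap, hquad]
  simp

lemma norm_algebraMap_add_smul [Fintype F] [Fintype K] (hquad : Module.finrank F K = 2) {δ : K}
    (hδ : Algebra.trace F K δ = 0) (a b : F) :
    Algebra.norm F (algebraMap F K a + b • δ) = a ^ 2 + Algebra.norm F δ * b ^ 2 := by
  have hnorm (x : K) : algebraMap F K (Algebra.norm F x) = x * x ^ Fintype.card F := by
    rw [FiniteField.algebraMap_norm_eq_prod_pow, hquad]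
    simp [prod_range_succ]
  have hconj : δ ^ Fintype.card F = -δ := by
    have h := FiniteField.algebraMap_trace_eq_sum_pow F K δ
    rw [hδ, hquad] at h
    simp only [sum_range_succ, map_zero, range_zero, sum_empty, zero_add, pow_zero, pow_one] at h
    rw [Nat.card_eq_fintype_card] at h
    exact (neg_eq_of_add_eq_zero_right h.symm).symm
  have hfrob : (algebraMap F K a + b • δ) ^ Fintype.card F = algebraMap F K a - b • δ := by
    have h : FiniteField.frobeniusAlgHom F K (algebraMap F K a + b • δ) =
        algebraMap F K a + b • FiniteField.frobeniusAlgHom F K δ := by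
      rw [map_add, map_smul, AlgHom.commutes]
    simpa [hconj, sub_eq_add_neg] using h
  apply (algebraMap F K).injective
  rw [hnorm, hfrob, map_add, map_mul, hnorm, hconj, map_pow, map_pow, Algebra.smul_def]
  ring

lemma not_isSquare_neg_norm_of_trace_eq_zero [Fintype F] [Fintype K] (hF : ringChar F ≠ 2)
    (hquad : Module.finrank F K = 2) {δ : K} (hδ0 : δ ≠ 0) (hδ : Algebra.trace F K δ = 0) :
    ¬IsSquare (-Algebra.norm F δ) := by
  rintro ⟨c, hc⟩
  have h : Algebra.norm F (algebraMap F K c + (1 : F) • δ) = 0 := by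
    rw [norm_algebraMap_add_smul hquad hδ]
    linear_combination -hc
  rw [Algebra.norm_eq_zero_iff] at h
  have ht := trace_algebraMap_add_smul hquad hδ c 1
  rw [h, map_zero] at ht
  have hc0 : c = 0 := by simpa [Ring.two_ne_zero hF] using ht.symm
  rw [hc0] at h
  exact hδ0 (by simpa using h)

lemma bijective_algebraMap_add_smul [Fintype F] [Fintype K] (hF : ringChar F ≠ 2)
    (hquad : Module.finrank F K = 2) {δ : K} (hδ0 : δ ≠ 0) (hδ : Algebra.trace F K δ = 0) :
    Function.Bijective fun p : F × F => algebraMap F K p.1 + p.2 • δ := by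
  rw [Fintype.bijective_iff_injective_and_card]
  constructor
  · rintro ⟨a, b⟩ ⟨a', b'⟩ h
    dsimp only at h
    have ht := congrArg (Algebra.trace F K) h
    rw [trace_algebraMap_add_smul hquad hδ, trace_algebraMap_add_smul hquad hδ] at ht
    obtain rfl := mul_left_cancel₀ (Ring.two_ne_zero hF) ht
    rw [smul_left_injective F hδ0 (add_left_cancel h)]
  · rw [Fintype.card_prod, Module.card_eq_pow_finrank (K := F) (V := K), hquad, sq]

end QuadraticExtension

/-- Let `F` be a finite field of odd characteristic with `q` elements
and `K/F` a quadratic extension. For a nontrivial multiplicative character `χ` and a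
nontrivial additive character `ψ` of `F`:
`∑_{x ∈ Kˣ, Tr(x) ≠ 0} χ(N_{K/F}(x · Tr_{K/F}(x)⁻¹))
  = -(q-1) q⁻¹ (∑_{x ∈ Fˣ} χ(x) ψ(x))² (∑_{z ∈ Fˣ} χ(z)⁻² ψ(z))`. -/
theorem quadratic_trace_norm_sum
    (F K : Type*) [Field F] [Fintype F] [DecidableEq F]
    [Field K] [Fintype K] [DecidableEq K] [Algebra F K]
    (hF : ringChar F ≠ 2) (hquad : Module.finrank F K = 2)
    (χ : MulChar F ℂ) (hχ : χ ≠ 1)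
    (ψ : AddChar F ℂ) (hψ : ψ ≠ 1) :
    ∑ x ∈ Finset.univ.filter (fun x : Kˣ => Algebra.trace F K (x : K) ≠ 0),
      χ (Algebra.norm F ((x : K) * (algebraMap F K (Algebra.trace F K (x : K)))⁻¹)) =
    -((Fintype.card F : ℂ) - 1) * (Fintype.card F : ℂ)⁻¹ *
      (∑ x : Fˣ, χ (x : F) * ψ (x : F)) ^ 2 *
      (∑ z : Fˣ, (χ (z : F) ^ 2)⁻¹ * ψ (z : F)) := by
  have h2 : (2 : F) ≠ 0 := Ring.two_ne_zero hF
  obtain ⟨δ, hδ, hδ0⟩ := (Submodule.ne_bot_iff _).1 <|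
    LinearMap.ker_ne_bot_of_finrank_lt (f := Algebra.trace F K) (by simp [hquad])
  rw [LinearMap.mem_ker] at hδ
  set d := -Algebra.norm F δ with hd
  have hdsq : ¬IsSquare d := not_isSquare_neg_norm_of_trace_eq_zero hF hquad hδ0 hδ
  let g : K → ℂ := fun x => if Algebra.trace F K x ≠ 0 then
    χ (Algebra.norm F (x * (algebraMap F K (Algebra.trace F K x))⁻¹)) else 0
  have hunits : ∑ x ∈ Finset.univ.filter (fun x : Kˣ => Algebra.trace F K (x : K) ≠ 0),
      χ (Algebra.norm F ((x : K) * (algebraMap F K (Algebra.trace F K (x : K)))⁻¹)) =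
      ∑ x : K, g x := by
    rw [sum_filter, sum_eq_sum_units_of_map_zero g (by simp [g])]
  have hinner (a : F) : ∑ b : F, g (algebraMap F K a + b • δ) =
      if a = 0 then 0 else -jacobiSum χ χ := by
    split_ifs with ha
    · refine sum_eq_zero fun b _ => if_neg ?_
      rw [not_not, trace_algebraMap_add_smul hquad hδ, ha, mul_zero]
    · have h2a : 2 * a ≠ 0 := mul_ne_zero h2 ha
      rw [← sum_mulChar_sub_mul_sq hF hdsq hχ, ← Equiv.sum_comp (Equiv.mulLeft₀ (2 * a) h2a)]
      refine sum_congr rfl fun b _ => ?_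
      have hx : (algebraMap F K a + (2 * a * b) • δ) * (algebraMap F K (2 * a))⁻¹ =
          algebraMap F K (1 / 2) + b • δ := by
        rw [mul_inv_eq_iff_eq_mul₀ (by simpa using h2a), add_mul, ← map_mul, smul_mul_assoc,
          mul_comm δ, ← Algebra.smul_def, smul_smul]
        congr 2 <;> field_simp
      change (if _ then χ (Algebra.norm F ((algebraMap F K a + (2 * a * b) • δ) * _)) else 0) = _
      rw [Equiv.mulLeft₀_apply, trace_algebraMap_add_smul hquad hδ, if_pos h2a, hx,
        norm_algebraMap_add_smul hquad hδ, hd]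
      congr 1
      rw [one_div_pow, show (2 : F) ^ 2 = 4 by norm_num]
      ring
  rw [hunits, ← (bijective_algebraMap_add_smul hF hquad hδ0 hδ).sum_comp g,
    Fintype.sum_prod_type]
  simp only [hinner]
  have hpow : ∑ z : Fˣ, (χ (z : F) ^ 2)⁻¹ * ψ (z : F) = gaussSum (χ ^ 2)⁻¹ ψ := by
    rw [gaussSum_eq_sum_units]
    refine sum_congr rfl fun z _ => ?_
    rw [MulChar.inv_apply_eq_inv, MulChar.pow_apply_coe, Ring.inverse_eq_inv']
  have hcount : ∑ a : F, (if a = 0 then 0 else -jacobiSum χ χ) =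
      ((Fintype.card F : ℂ) - 1) * -jacobiSum χ χ := by
    rw [sum_ite, sum_const_zero, zero_add, sum_const, nsmul_eq_mul, filter_ne',
      card_erase_of_mem (mem_univ _), card_univ, Nat.cast_sub Fintype.card_pos, Nat.cast_one]
  rw [hcount, hpow, ← gaussSum_eq_sum_units, jacobiSum_self_eq_gaussSum hχ hψ]
  ring
end

section
/- Let E be a finite field of odd characteristic, k ≥ 1, ψ a nontrivial additive character of E, and let π be a representation of GL_k(E) on a finite-dimensional complex vector space V. Let M be the subgroup of GL_k(E) consisting of all block matrices of the form (I_{k−1} X; 0 t) with X a column vector in E^{k−1} and t ∈ Eˣ (for k = 1, M = GL_1(E)). Assume that the only ℂ-linear map T : V → V satisfying T ∘ π(m) = T for every m ∈ M is T = 0. Then ∑_{g ∈ GL_k(E), det(I+g) ≠ 0} π(g) = |E|^{−k²} · (∑_{v ∈ GL_k(E)} ψ(tr v)) · (∑_{y ∈ GL_k(E)} ψ(tr y) π(y⁻¹)) ∘ (∑_{x ∈ GL_k(E)} ψ(tr x) π(x)). -/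
open scoped MatrixGroups

theorem sum_addChar_trace_mul {E n : Type*} [Field E] [Fintype E] [DecidableEq E]
    [Fintype n] [DecidableEq n] {ψ : AddChar E ℂ} (hψ : ψ ≠ 1) (B : Matrix n n E) :
    ∑ A : Matrix n n E, ψ (B * A).trace =
      if B = 0 then (Fintype.card (Matrix n n E) : ℂ) else 0 := by
  split_ifs with hB
  · simp [hB]
  · obtain ⟨i, j, hij⟩ : ∃ i j, B i j ≠ 0 := by
      by_contra! h
      exact hB (Matrix.ext h)
    obtain ⟨t, ht⟩ := AddChar.ne_one_iff.1 hψ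
    let χ : AddChar (Matrix n n E) ℂ := ψ.compAddMonoidHom
      ((Matrix.traceAddMonoidHom n E).comp (AddMonoidHom.mulLeft B))
    have hχ : χ ≠ 1 := by
      refine AddChar.ne_one_iff.2 ⟨Matrix.single j i ((B i j)⁻¹ * t), ?_⟩
      have h : (B * Matrix.single j i ((B i j)⁻¹ * t)).trace = t := by
        rw [Matrix.trace_mul_single]
        simp [hij]
      simpa [χ, h] using ht
    exact AddChar.sum_eq_zero_of_ne_one hχ

theorem exists_mul_row_eq_zero {E n : Type*} [Field E] [Fintype n] [DecidableEq n]
    {A : Matrix n n E} (hA : A.det = 0) (l : n) :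
    ∃ P : GL n E, ∀ j, ((P : Matrix n n E) * A) l j = 0 := by
  obtain ⟨w, hw, hwA⟩ := Matrix.exists_vecMul_eq_zero_iff.2 hA
  obtain ⟨i, hi⟩ := Function.ne_iff.1 hw
  let Q : Matrix n n E := (1 : Matrix n n E).updateRow i w
  have hQ : Q.det = w i := by
    rw [← Matrix.cramer_transpose_apply, Matrix.transpose_one, Matrix.cramer_one]
    rfl
  let P : Matrix n n E := Q.submatrix (Equiv.swap i l) id
  have hP : P.det ≠ 0 := by
    rw [Matrix.det_permute, hQ]
    refine mul_ne_zero ?_ hi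
    rcases Int.units_eq_one_or (Equiv.Perm.sign (Equiv.swap i l)) with h | h <;> simp [h]
  refine ⟨Matrix.GeneralLinearGroup.mkOfDetNeZero P hP, fun j => ?_⟩
  have hrow : P l = w := by
    ext j
    simp [P, Q]
  change (P * A) l j = 0
  rw [Matrix.mul_apply_eq_vecMul, hrow, hwA]
  rfl

theorem mul_eq_self_of_row_eq_zero {E n : Type*} [Field E] [Fintype n] [DecidableEq n]
    {g B : Matrix n n E} {l : n} (hg : ∀ i j, j ≠ l → g i j = if i = j then 1 else 0)
    (hB : ∀ j, B l j = 0) : g * B = B := by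
  ext i j
  trans ((1 : Matrix n n E) * B) i j
  · rw [Matrix.mul_apply, Matrix.mul_apply]
    refine Finset.sum_congr rfl fun a _ => ?_
    by_cases ha : a = l
    · simp [ha, hB]
    · rw [hg i a ha, Matrix.one_apply]
  · rw [one_mul]

section FourierTransform

variable {E n V : Type*} [Field E] [Fintype E] [DecidableEq E] [Fintype n] [DecidableEq n]
  [AddCommGroup V] [Module ℂ V]

/-- The Fourier transform at the matrix `A` of a representation of `GL n E`, extended by zero to
singular matrices. -/
noncomputable def repFourier (ψ : AddChar E ℂ) (π : Representation ℂ (GL n E) V)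
    (A : Matrix n n E) : V →ₗ[ℂ] V :=
  ∑ z : GL n E, ψ ((z : Matrix n n E) * A).trace • π z

theorem repFourier_comp (ψ : AddChar E ℂ) (π : Representation ℂ (GL n E) V)
    (A : Matrix n n E) (h : GL n E) :
    repFourier ψ π ((h : Matrix n n E) * A) ∘ₗ π h = repFourier ψ π A := by
  simp only [repFourier]
  rw [← Module.End.mul_eq_comp, Finset.sum_mul]
  refine Fintype.sum_equiv (Equiv.mulRight h) _ _ fun z => ?_
  simp [mul_assoc]

theorem repFourier_coe (ψ : AddChar E ℂ) (π : Representation ℂ (GL n E) V) (y : GL n E) :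
    repFourier ψ π (y : Matrix n n E) =
      π y⁻¹ ∘ₗ ∑ x : GL n E, ψ (x : Matrix n n E).trace • π x := by
  simp only [repFourier]
  rw [← Module.End.mul_eq_comp, Finset.mul_sum]
  refine Fintype.sum_equiv (Equiv.mulLeft y) _ _ fun z => ?_
  rw [Matrix.trace_mul_comm]
  simp [← map_mul]

theorem repFourier_eq_zero_of_det_eq_zero (ψ : AddChar E ℂ) (π : Representation ℂ (GL n E) V)
    (l : n)
    (hM : ∀ T : V →ₗ[ℂ] V,
      (∀ g : GL n E, (∀ i j, j ≠ l → (g : Matrix n n E) i j = if i = j then 1 else 0) →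
        T ∘ₗ π g = T) → T = 0)
    {A : Matrix n n E} (hA : A.det = 0) : repFourier ψ π A = 0 := by
  obtain ⟨P, hP⟩ := exists_mul_row_eq_zero hA l
  have h : repFourier ψ π ((P : Matrix n n E) * A) = 0 := by
    refine hM _ fun g hg => ?_
    have := repFourier_comp ψ π ((P : Matrix n n E) * A) g
    rwa [mul_eq_self_of_row_eq_zero hg hP] at this
  rw [← repFourier_comp ψ π A P, h, LinearMap.zero_comp]

theorem sum_repFourier (ψ : AddChar E ℂ) (π : Representation ℂ (GL n E) V) (hψ : ψ ≠ 1)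
    (B : Matrix n n E) :
    ∑ A : Matrix n n E, ψ (B * A).trace • repFourier ψ π A =
      (Fintype.card (Matrix n n E) : ℂ) •
        ∑ g : GL n E, if B + (g : Matrix n n E) = 0 then π g else 0 := by
  simp only [repFourier, Finset.smul_sum, smul_smul]
  rw [Finset.sum_comm]
  refine Finset.sum_congr rfl fun g _ => ?_
  rw [← Finset.sum_smul]
  simp only [← AddChar.map_add_eq_mul, ← Matrix.trace_add, ← add_mul]
  rw [sum_addChar_trace_mul hψ]
  split_ifs <;> simp

theorem sum_GL_eq_sum_matrix {M : Type*} [AddCommMonoid M] (f : Matrix n n E → M)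
    (hf : ∀ A, A.det = 0 → f A = 0) :
    ∑ g : GL n E, f (g : Matrix n n E) = ∑ A : Matrix n n E, f A := by
  refine Finset.sum_of_injOn (fun g : GL n E => (g : Matrix n n E))
    (fun a _ b _ h => Units.ext h) (by simp) (fun A _ hA => hf A ?_) (fun _ _ => rfl)
  by_contra h
  exact hA ⟨Matrix.GeneralLinearGroup.mkOfDetNeZero A h, by simp, rfl⟩

theorem sum_addChar_trace_neg_mul (ψ : AddChar E ℂ) (y : GL n E) :
    ∑ v : GL n E, ψ (-(v : Matrix n n E) * (y : Matrix n n E)).trace =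
      ∑ v : GL n E, ψ (v : Matrix n n E).trace := by
  refine Fintype.sum_equiv (Equiv.mulRight (-y)) _ _ fun v => ?_
  simp

theorem sum_repFourier_weighted (ψ : AddChar E ℂ) (π : Representation ℂ (GL n E) V)
    (hψ : ψ ≠ 1) :
    ∑ A : Matrix n n E, ((∑ v : GL n E, ψ (-(v : Matrix n n E) * A).trace) * ψ A.trace) •
        repFourier ψ π A =
      (Fintype.card (Matrix n n E) : ℂ) •
        ∑ g ∈ Finset.univ.filter
          (fun g : GL n E => (1 + (g : Matrix n n E)).det ≠ 0), π g := by
  have key (A : Matrix n n E) :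
      ((∑ v : GL n E, ψ (-(v : Matrix n n E) * A).trace) * ψ A.trace) • repFourier ψ π A =
        ∑ v : GL n E, ψ ((1 - (v : Matrix n n E)) * A).trace • repFourier ψ π A := by
    rw [Finset.sum_mul, Finset.sum_smul]
    refine Finset.sum_congr rfl fun v _ => ?_
    rw [← AddChar.map_add_eq_mul, ← Matrix.trace_add]
    congr 3
    noncomm_ring
  simp only [key]
  rw [Finset.sum_comm]
  simp only [sum_repFourier ψ π hψ]
  rw [← Finset.smul_sum, Finset.sum_comm, Finset.sum_filter]
  congr 1
  refine Finset.sum_congr rfl fun g _ => ?_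
  have hcond (v : GL n E) : 1 - (v : Matrix n n E) + (g : Matrix n n E) = 0 ↔
      (v : Matrix n n E) = 1 + (g : Matrix n n E) := by
    rw [sub_add_eq_add_sub, sub_eq_zero, eq_comm]
  simp only [hcond]
  split_ifs with h
  · rw [Finset.sum_eq_single (Matrix.GeneralLinearGroup.mkOfDetNeZero _ h)]
    · exact if_pos rfl
    · exact fun v _ hv => if_neg fun h' => hv (Units.ext h')
    · simp
  · refine Finset.sum_eq_zero fun v _ => if_neg fun h' => h ?_
    rw [← h']
    exact v.det_ne_zero

end FourierTransform

/-- Let `E` be a finite field of odd characteristic, `k ≥ 1`, `ψ` a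
nontrivial additive character of `E`, and `π` a representation of `GL_k(E)` on a
finite-dimensional complex vector space `V`. Assume the only linear map `T : V → V` with
`T ∘ π(m) = T` for all `m` in the subgroup `M` of block matrices `(I_{k-1} X; 0 t)` is
`T = 0`. Then `∑_{g, det(I+g) ≠ 0} π(g) = |E|^{-k²} (∑_v ψ(tr v)) ·
(∑_y ψ(tr y) π(y⁻¹)) ∘ (∑_x ψ(tr x) π(x))`. -/
theorem jacobi_sum_operator_trivial_character
    (E : Type*) [Field E] [Fintype E] [DecidableEq E] (hE : ringChar E ≠ 2)
    (k : ℕ) (hk : 1 ≤ k)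
    (ψ : AddChar E ℂ) (hψ : ψ ≠ 1)
    (V : Type*) [AddCommGroup V] [Module ℂ V] [FiniteDimensional ℂ V]
    (π : Representation ℂ (GL (Fin k) E) V)
    (hM : ∀ T : V →ₗ[ℂ] V,
      (∀ g : GL (Fin k) E,
        (∀ i j : Fin k, (j : ℕ) < k - 1 →
          (g : Matrix (Fin k) (Fin k) E) i j = if i = j then 1 else 0) →
        T ∘ₗ π g = T) → T = 0) :
    (∑ g ∈ Finset.univ.filter
        (fun g : GL (Fin k) E => (1 + (g : Matrix (Fin k) (Fin k) E)).det ≠ 0), π g) =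
    ((Fintype.card E : ℂ) ^ (-(k ^ 2 : ℤ)) *
        ∑ v : GL (Fin k) E, ψ ((v : Matrix (Fin k) (Fin k) E).trace)) •
      ((∑ y : GL (Fin k) E, ψ ((y : Matrix (Fin k) (Fin k) E).trace) • π y⁻¹) ∘ₗ
        (∑ x : GL (Fin k) E, ψ ((x : Matrix (Fin k) (Fin k) E).trace) • π x)) := by
  have hM' : ∀ T : V →ₗ[ℂ] V,
      (∀ g : GL (Fin k) E, (∀ i j, j ≠ (⟨k - 1, by omega⟩ : Fin k) →
        (g : Matrix (Fin k) (Fin k) E) i j = if i = j then 1 else 0) → T ∘ₗ π g = T) → T = 0 :=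
    fun T hT => hM T fun g hg => hT g fun i j hj =>
      hg i j (by have := Fin.val_ne_of_ne hj; dsimp only at this; omega)
  have hcard : (Fintype.card (Matrix (Fin k) (Fin k) E) : ℂ) =
      (Fintype.card E : ℂ) ^ (k ^ 2 : ℕ) := by
    change (Fintype.card (Fin k → Fin k → E) : ℂ) = _
    simp [sq, pow_mul]
  have hq : (Fintype.card E : ℂ) ^ (k ^ 2 : ℕ) ≠ 0 :=
    pow_ne_zero _ (Nat.cast_ne_zero.2 Fintype.card_ne_zero)
  have hsum := sum_repFourier_weighted ψ π hψ
  rw [← sum_GL_eq_sum_matrix _ fun A hA => by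
    rw [repFourier_eq_zero_of_det_eq_zero ψ π _ hM' hA, smul_zero]] at hsum
  simp only [sum_addChar_trace_neg_mul, mul_smul, repFourier_coe, hcard] at hsum
  rw [← Finset.smul_sum] at hsum
  simp only [← Module.End.mul_eq_comp, ← smul_mul_assoc, ← Finset.sum_mul] at hsum
  rw [mul_smul, ← Module.End.mul_eq_comp, ← smul_mul_assoc, hsum, smul_smul,
    show (-(k ^ 2 : ℤ)) = -((k ^ 2 : ℕ) : ℤ) by push_cast; rfl,
    zpow_neg, zpow_natCast, inv_mul_cancel₀ hq, one_smul]
end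

section
/- Let E be a finite field of odd characteristic, k ≥ 1, ψ a nontrivial additive character of E, and let π be a representation of GL_k(E) on a finite-dimensional complex vector space V. Let M be the subgroup of GL_k(E) consisting of all block matrices of the form (I_{k−1} X; 0 t) with X a column vector in E^{k−1} and t ∈ Eˣ (for k = 1, M = GL_1(E)). Assume that the only ℂ-linear map T : V → V satisfying T ∘ π(m) = T for every m ∈ M is T = 0, and suppose a, b ∈ ℂ satisfy ∑_{g ∈ GL_k(E)} ψ(tr g) π(g) = a · id_V and ∑_{g ∈ GL_k(E)} ψ(tr(g⁻¹)) π(g) = b · id_V (by Schur's lemma such scalars exist when π is irreducible). Then ∑_{g ∈ GL_k(E), det(I+g) ≠ 0} π(g) = (−1)^k · |E|^{−k(k+1)/2} · a · b · id_V. -/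
open scoped MatrixGroups

/-- A sum over square block matrices is an iterated sum over the blocks. -/
theorem Matrix.sum_fromBlocks {E m n R : Type*} [Fintype E] [AddCommMonoid R] [Fintype m]
    [Fintype n] [DecidableEq m] [DecidableEq n] (f : Matrix (m ⊕ n) (m ⊕ n) E → R) :
    ∑ y, f y = ∑ A : Matrix m m E, ∑ B : Matrix m n E, ∑ C : Matrix n m E, ∑ D : Matrix n n E,
      f (Matrix.fromBlocks A B C D) := by
  let e : Matrix m m E × Matrix m n E × Matrix n m E × Matrix n n E ≃
      Matrix (m ⊕ n) (m ⊕ n) E :=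
    { toFun := fun p => Matrix.fromBlocks p.1 p.2.1 p.2.2.1 p.2.2.2
      invFun := fun y => (y.toBlocks₁₁, y.toBlocks₁₂, y.toBlocks₂₁, y.toBlocks₂₂)
      left_inv := fun p => by simp
      right_inv := fun y => Matrix.fromBlocks_toBlocks y }
  rw [← e.sum_comp]
  simp only [Fintype.sum_prod_type]
  rfl

theorem Matrix.trace_fromBlocks_eq_add {m n R : Type*} [AddCommMonoid R] [Fintype m] [Fintype n]
    (A : Matrix m m R) (B : Matrix m n R) (C : Matrix n m R) (D : Matrix n n R) :
    (Matrix.fromBlocks A B C D).trace = A.trace + D.trace := by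
  simp [Matrix.trace]

section GaussSum

variable {E : Type*} [Field E] [Fintype E] [DecidableEq E]

/-- Orthogonality of the additive characters `y ↦ ψ (tr (B y))` of a space of matrices. -/
theorem AddChar.sum_trace_mul_eq_ite {m n : Type*} [Fintype m] [Fintype n] [DecidableEq m]
    [DecidableEq n] {ψ : AddChar E ℂ} (hψ : ψ ≠ 1) (B : Matrix m n E) :
    ∑ y : Matrix n m E, ψ (B * y).trace =
      if B = 0 then (Fintype.card E : ℂ) ^ (Fintype.card n * Fintype.card m) else 0 := by
  split_ifs with hB
  · subst hB
    have hcard : Fintype.card (Matrix n m E) =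
        Fintype.card E ^ (Fintype.card n * Fintype.card m) := by
      rw [← Fintype.card_prod, ← Fintype.card_fun]
      exact Fintype.card_congr (Equiv.curry n m E).symm
    simp [hcard]
  · let φ : Matrix n m E →+ E :=
      { toFun := fun y => (B * y).trace
        map_zero' := by simp
        map_add' := fun x y => by simp [Matrix.mul_add] }
    refine AddChar.sum_eq_zero_of_ne_one (ψ := ψ.compAddMonoidHom φ) ?_
    obtain ⟨i, j, hij⟩ : ∃ i j, B i j ≠ 0 := by
      by_contra! h
      exact hB (Matrix.ext h)
    obtain ⟨c, hc⟩ := AddChar.ne_one_iff.mp hψ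
    refine AddChar.ne_one_iff.mpr ⟨Matrix.single j i ((B i j)⁻¹ * c), ?_⟩
    have : φ (Matrix.single j i ((B i j)⁻¹ * c)) = c := by
      simp [φ, Matrix.trace_mul_single, hij]
    rwa [AddChar.compAddMonoidHom_apply, this]

/-- The Gauss sum over invertible matrices, as a sum over all square matrices. -/
noncomputable def matrixGaussSum (ψ : AddChar E ℂ) (m : Type*) [Fintype m] [DecidableEq m] : ℂ :=
  ∑ y : Matrix m m E, if y.det ≠ 0 then ψ y.trace else 0

theorem matrixGaussSum_congr (ψ : AddChar E ℂ) {m n : Type*} [Fintype m] [DecidableEq m]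
    [Fintype n] [DecidableEq n] (e : m ≃ n) : matrixGaussSum ψ m = matrixGaussSum ψ n := by
  unfold matrixGaussSum
  rw [← (Matrix.reindex e e).sum_comp]
  refine Finset.sum_congr rfl fun y _ => ?_
  have : (Matrix.reindex e e y).trace = y.trace := by
    simp only [Matrix.trace, Matrix.diag, Matrix.reindex_apply, Matrix.submatrix_apply]
    exact e.symm.sum_comp fun i => y i i
  rw [Matrix.det_reindex_self, this]

theorem matrixGaussSum_unit {ψ : AddChar E ℂ} (hψ : ψ ≠ 1) : matrixGaussSum ψ Unit = -1 := by
  have h0 : ∑ x : E, ψ x = 0 := AddChar.sum_eq_zero_of_ne_one hψ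
  have h1 : matrixGaussSum ψ Unit = ∑ x : E, if x ≠ 0 then ψ x else 0 := by
    refine Fintype.sum_equiv Matrix.uniqueEquiv _ _ fun y => ?_
    by_cases hy : y PUnit.unit PUnit.unit = 0 <;> simp [Matrix.trace, Matrix.uniqueEquiv, hy]
  rw [h1]
  have h2 : ∀ x : E, (if x ≠ 0 then ψ x else 0) = ψ x - if x = 0 then 1 else 0 := by
    intro x
    by_cases hx : x = 0 <;> simp [hx]
  simp [h2, h0]

theorem matrixGaussSum_sum_unit {ψ : AddChar E ℂ} (hψ : ψ ≠ 1) (m : Type*) [Fintype m]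
    [DecidableEq m] :
    matrixGaussSum ψ (m ⊕ Unit) =
      -(Fintype.card E : ℂ) ^ Fintype.card m * matrixGaussSum ψ m := by
  set q : ℂ := (Fintype.card E : ℂ) ^ Fintype.card m with hq
  have hq0 : q ≠ 0 := pow_ne_zero _ (Nat.cast_ne_zero.mpr Fintype.card_ne_zero)
  let F : Matrix (m ⊕ Unit) (m ⊕ Unit) E → ℂ := fun y => if y.det ≠ 0 then ψ y.trace else 0
  have htrans : ∀ X : Matrix m Unit E, matrixGaussSum ψ (m ⊕ Unit) =
      ∑ y, F y * ψ (y.toBlocks₂₁ * X).trace := by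
    intro X
    let u : (Matrix (m ⊕ Unit) (m ⊕ Unit) E)ˣ :=
      { val := Matrix.fromBlocks 1 X 0 1
        inv := Matrix.fromBlocks 1 (-X) 0 1
        val_inv := by simp [Matrix.fromBlocks_multiply]
        inv_val := by simp [Matrix.fromBlocks_multiply] }
    have hdet : (u : Matrix (m ⊕ Unit) (m ⊕ Unit) E).det = 1 := by
      simp [u]
    unfold matrixGaussSum
    rw [← Equiv.sum_comp u.mulRight]
    refine Finset.sum_congr rfl fun y _ => ?_
    have htr : (y * (u : Matrix (m ⊕ Unit) (m ⊕ Unit) E)).trace =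
        y.trace + (y.toBlocks₂₁ * X).trace := by
      conv_lhs => rw [← Matrix.fromBlocks_toBlocks y]
      conv_rhs => rw [← Matrix.fromBlocks_toBlocks y]
      simp only [u, Matrix.fromBlocks_multiply, Matrix.trace_fromBlocks_eq_add, Matrix.trace_add,
        Matrix.mul_one, Matrix.mul_zero, add_zero, Matrix.toBlocks_fromBlocks₂₁]
      ring
    simp only [Units.mulRight_apply, Matrix.det_mul, hdet, mul_one, htr, F]
    split_ifs
    · rw [AddChar.map_add_eq_mul]
    · simp
  have hsum : q * matrixGaussSum ψ (m ⊕ Unit) =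
      q * ∑ y, F y * if y.toBlocks₂₁ = 0 then 1 else 0 := by
    calc q * matrixGaussSum ψ (m ⊕ Unit)
        = ∑ _X : Matrix m Unit E, matrixGaussSum ψ (m ⊕ Unit) := by
          have := AddChar.sum_trace_mul_eq_ite hψ (0 : Matrix Unit m E)
          simp only [Matrix.zero_mul, Matrix.trace_zero, AddChar.map_zero_eq_one,
            Finset.sum_const, nsmul_eq_mul, mul_one, if_true, Fintype.card_unit] at this
          rw [Finset.sum_const, nsmul_eq_mul, this, hq]
      _ = ∑ X : Matrix m Unit E, ∑ y, F y * ψ (y.toBlocks₂₁ * X).trace :=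
          Finset.sum_congr rfl fun X _ => htrans X
      _ = q * ∑ y, F y * if y.toBlocks₂₁ = 0 then 1 else 0 := by
          rw [Finset.sum_comm, Finset.mul_sum]
          refine Finset.sum_congr rfl fun y _ => ?_
          rw [← Finset.mul_sum, AddChar.sum_trace_mul_eq_ite hψ]
          split_ifs <;> simp [hq, mul_comm]
  rw [mul_left_cancel₀ hq0 hsum, Matrix.sum_fromBlocks]
  have hblock : ∀ (A : Matrix m m E) (B : Matrix m Unit E),
      (∑ C : Matrix Unit m E, ∑ D : Matrix Unit Unit E,
        F (Matrix.fromBlocks A B C D) *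
          if (Matrix.fromBlocks A B C D).toBlocks₂₁ = 0 then 1 else 0) =
      (if A.det ≠ 0 then ψ A.trace else 0) * matrixGaussSum ψ Unit := by
    intro A B
    rw [Finset.sum_eq_single 0]
    · unfold matrixGaussSum
      rw [Finset.mul_sum]
      refine Finset.sum_congr rfl fun D _ => ?_
      simp only [F, Matrix.toBlocks_fromBlocks₂₁, if_true, mul_one,
        Matrix.det_fromBlocks_zero₂₁, Matrix.trace_fromBlocks_eq_add, AddChar.map_add_eq_mul]
      by_cases hA : A.det = 0 <;> by_cases hD : D.det = 0 <;>
        simp only [hA, hD, ne_eq, not_true_eq_false, not_false_eq_true, mul_eq_zero, or_self,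
          if_true, if_false, zero_mul, mul_zero]
    · intro C _ hC
      simp [hC]
    · simp
  have hcard : (Fintype.card (Matrix m Unit E) : ℂ) = q := by
    have := AddChar.sum_trace_mul_eq_ite hψ (0 : Matrix Unit m E)
    simpa [hq] using this
  simp only [hblock, matrixGaussSum_unit hψ, Finset.sum_const, Finset.card_univ, nsmul_eq_mul,
    hcard]
  rw [← Finset.mul_sum, ← Finset.sum_mul]
  unfold matrixGaussSum
  ring

theorem matrixGaussSum_fin {ψ : AddChar E ℂ} (hψ : ψ ≠ 1) (k : ℕ) :
    matrixGaussSum ψ (Fin k) = (-1) ^ k * (Fintype.card E : ℂ) ^ (k * (k - 1) / 2) := by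
  induction k with
  | zero =>
    have : Fintype.card (Matrix (Fin 0) (Fin 0) E) = 1 :=
      Fintype.card_eq_one_iff.mpr ⟨0, fun _ => Subsingleton.elim _ _⟩
    simp [matrixGaussSum, this]
  | succ n ih =>
    have e : Fin n ⊕ Unit ≃ Fin (n + 1) :=
      Fintype.equivOfCardEq (by simp)
    rw [← matrixGaussSum_congr ψ e, matrixGaussSum_sum_unit hψ, ih, Fintype.card_fin,
      ← Finset.sum_range_id, ← Finset.sum_range_id, Finset.sum_range_succ]
    ring

/-- The Gauss sum of the trivial representation of `GL_k`. -/
theorem sum_GL_addChar_trace {ψ : AddChar E ℂ} (hψ : ψ ≠ 1) (k : ℕ) :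
    ∑ g : GL (Fin k) E, ψ (g : Matrix (Fin k) (Fin k) E).trace =
      (-1) ^ k * (Fintype.card E : ℂ) ^ (k * (k - 1) / 2) := by
  rw [← matrixGaussSum_fin hψ, matrixGaussSum, ← Finset.sum_filter]
  refine Finset.sum_bij (fun g _ => (g : Matrix (Fin k) (Fin k) E)) ?_ ?_ ?_ ?_
  · intro g _
    simpa using (Matrix.isUnit_iff_isUnit_det _).mp g.isUnit |>.ne_zero
  · intro g _ h _ hgh
    exact Units.ext hgh
  · intro y hy
    exact ⟨Matrix.GeneralLinearGroup.mkOfDetNeZero y (by simpa using hy), Finset.mem_univ _, rfl⟩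
  · intro g _
    rfl

end GaussSum

/-- Every nonzero vector is a given row of some invertible matrix. -/
theorem Matrix.exists_GL_row_eq {E n : Type*} [Field E] [Fintype n] [DecidableEq n] (i : n)
    {v : n → E} (hv : v ≠ 0) : ∃ P : GL n E, (P : Matrix n n E) i = v := by
  obtain ⟨j, hj⟩ := Function.ne_iff.mp hv
  have hdet : ((1 : Matrix n n E).updateRow j v).det ≠ 0 := by
    rw [← Matrix.cramer_transpose_apply]
    simpa using hj
  refine ⟨Matrix.GeneralLinearGroup.mkOfDetNeZero
    (((1 : Matrix n n E).updateRow j v).submatrix (Equiv.swap i j) id) ?_, ?_⟩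
  · rw [Matrix.det_permute]
    exact mul_ne_zero (by
      rcases Int.units_eq_one_or (Equiv.Perm.sign (Equiv.swap i j)) with h | h <;> simp [h]) hdet
  · ext l
    simp [Matrix.GeneralLinearGroup.mkOfDetNeZero, Matrix.submatrix]

section Operators

variable {E : Type*} [Field E] [Fintype E] [DecidableEq E] {k : ℕ} {V : Type*} [AddCommGroup V]
  [Module ℂ V] (π : Representation ℂ (GL (Fin k) E) V) (ψ : AddChar E ℂ)

/-- The operator-valued Fourier transform `∑_g ψ(tr (g y)) π(g)`. -/
noncomputable def traceFourier (y : Matrix (Fin k) (Fin k) E) : V →ₗ[ℂ] V :=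
  ∑ g : GL (Fin k) E, ψ ((g : Matrix (Fin k) (Fin k) E) * y).trace • π g

theorem traceFourier_comp (h : GL (Fin k) E) (y : Matrix (Fin k) (Fin k) E) :
    traceFourier π ψ ((h : Matrix (Fin k) (Fin k) E) * y) ∘ₗ π h = traceFourier π ψ y := by
  unfold traceFourier
  rw [← Equiv.sum_comp (Equiv.mulRight h) fun g : GL (Fin k) E =>
    ψ ((g : Matrix (Fin k) (Fin k) E) * y).trace • π g]
  ext v
  simp only [LinearMap.comp_apply, LinearMap.sum_apply]
  refine Finset.sum_congr rfl fun g _ => ?_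
  simp only [Equiv.coe_mulRight, Units.val_mul, Matrix.mul_assoc, map_mul, LinearMap.smul_apply,
    Module.End.mul_apply]

theorem traceFourier_eq_zero (hk : 1 ≤ k)
    (hM : ∀ T : V →ₗ[ℂ] V,
      (∀ g : GL (Fin k) E,
        (∀ i j : Fin k, (j : ℕ) < k - 1 →
          (g : Matrix (Fin k) (Fin k) E) i j = if i = j then 1 else 0) →
        T ∘ₗ π g = T) → T = 0)
    {y : Matrix (Fin k) (Fin k) E} (hy : y.det = 0) : traceFourier π ψ y = 0 := by
  obtain ⟨v, hv, hvy⟩ := Matrix.exists_vecMul_eq_zero_iff.mpr hy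
  let l : Fin k := ⟨k - 1, by omega⟩
  obtain ⟨P, hP⟩ := Matrix.exists_GL_row_eq l hv
  have hrow : ∀ j, ((P : Matrix (Fin k) (Fin k) E) * y) l j = 0 := by
    intro j
    have := congrFun hvy j
    rwa [← hP] at this
  have hzero : traceFourier π ψ ((P : Matrix (Fin k) (Fin k) E) * y) = 0 := by
    refine hM _ fun m hm => ?_
    have hfix : (m : Matrix (Fin k) (Fin k) E) * ((P : Matrix (Fin k) (Fin k) E) * y) =
        (P : Matrix (Fin k) (Fin k) E) * y := by
      ext i j
      rw [Matrix.mul_apply, Finset.sum_congr rfl (g := fun x =>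
        if i = x then ((P : Matrix (Fin k) (Fin k) E) * y) x j else 0)]
      · simp
      · intro x _
        by_cases hx : x = l
        · simp [hx, hrow]
        · have : (x : ℕ) < k - 1 := by
            have := x.isLt
            have : (x : ℕ) ≠ k - 1 := fun h => hx (Fin.ext h)
            omega
          simp [hm i x this]
    conv_lhs => rw [← hfix]
    exact traceFourier_comp π ψ m _
  rw [← traceFourier_comp π ψ P y, hzero, LinearMap.zero_comp]

end Operators

/-- Let `E` be a finite field of odd characteristic, `k ≥ 1`, `ψ` a
nontrivial additive character of `E`, and `π` a representation of `GL_k(E)` on a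
finite-dimensional complex vector space `V`. Assume the only linear map `T : V → V` with
`T ∘ π(m) = T` for all `m` in the subgroup `M` of block matrices `(I_{k-1} X; 0 t)` is
`T = 0`, and suppose `∑_g ψ(tr g) π(g) = a • id` and `∑_g ψ(tr g⁻¹) π(g) = b • id`.
Then `∑_{g, det(I+g) ≠ 0} π(g) = (-1)^k |E|^{-k(k+1)/2} a b • id`. -/
theorem jacobi_sum_scalar_trivial_character
    (E : Type*) [Field E] [Fintype E] [DecidableEq E] (hE : ringChar E ≠ 2)
    (k : ℕ) (hk : 1 ≤ k)
    (ψ : AddChar E ℂ) (hψ : ψ ≠ 1)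
    (V : Type*) [AddCommGroup V] [Module ℂ V] [FiniteDimensional ℂ V]
    (π : Representation ℂ (GL (Fin k) E) V)
    (hM : ∀ T : V →ₗ[ℂ] V,
      (∀ g : GL (Fin k) E,
        (∀ i j : Fin k, (j : ℕ) < k - 1 →
          (g : Matrix (Fin k) (Fin k) E) i j = if i = j then 1 else 0) →
        T ∘ₗ π g = T) → T = 0)
    (a b : ℂ)
    (ha : ∑ g : GL (Fin k) E, ψ ((g : Matrix (Fin k) (Fin k) E).trace) • π g =
      a • (LinearMap.id : V →ₗ[ℂ] V))
    (hb : ∑ g : GL (Fin k) E,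
        ψ (((g⁻¹ : GL (Fin k) E) : Matrix (Fin k) (Fin k) E).trace) • π g =
      b • (LinearMap.id : V →ₗ[ℂ] V)) :
    (∑ g ∈ Finset.univ.filter
        (fun g : GL (Fin k) E => (1 + (g : Matrix (Fin k) (Fin k) E)).det ≠ 0), π g) =
    ((-1 : ℂ) ^ k * (Fintype.card E : ℂ) ^ (-(k * (k + 1) / 2 : ℕ) : ℤ) * a * b) •
      (LinearMap.id : V →ₗ[ℂ] V) := by
  set q : ℂ := (Fintype.card E : ℂ) with hq
  have hq0 : q ≠ 0 := Nat.cast_ne_zero.mpr Fintype.card_ne_zero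
  set K : ℂ := ∑ g : GL (Fin k) E, ψ (g : Matrix (Fin k) (Fin k) E).trace with hK
  have hKval : K = (-1) ^ k * q ^ (k * (k - 1) / 2) := sum_GL_addChar_trace hψ k
  have hneg : ∀ h : GL (Fin k) E,
      ∑ z : GL (Fin k) E, ψ (-((z : Matrix (Fin k) (Fin k) E) *
        (h : Matrix (Fin k) (Fin k) E)).trace) = K := by
    intro h
    rw [hK, ← Equiv.sum_comp (Equiv.mulRight (-h)) fun z : GL (Fin k) E =>
      ψ (z : Matrix (Fin k) (Fin k) E).trace]
    simp
  have hfourier : ∀ g : GL (Fin k) E,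
      ∑ y : Matrix (Fin k) (Fin k) E, ∑ z : GL (Fin k) E,
        ψ ((1 + (g : Matrix (Fin k) (Fin k) E) - (z : Matrix (Fin k) (Fin k) E)) * y).trace =
      if (1 + (g : Matrix (Fin k) (Fin k) E)).det ≠ 0 then q ^ (k * k) else 0 := by
    intro g
    rw [Finset.sum_comm]
    simp only [AddChar.sum_trace_mul_eq_ite hψ, Fintype.card_fin, sub_eq_zero]
    split_ifs with hg
    · rw [Finset.sum_eq_single (Matrix.GeneralLinearGroup.mkOfDetNeZero _ hg)]
      · exact if_pos rfl
      · intro z _ hz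
        exact if_neg fun h => hz (Units.ext h.symm)
      · simp
    · refine Finset.sum_eq_zero fun z _ => if_neg fun h => hg ?_
      rw [h]
      exact ((Matrix.isUnit_iff_isUnit_det _).mp z.isUnit).ne_zero
  have hinv : ∀ h : GL (Fin k) E,
      traceFourier π ψ (h : Matrix (Fin k) (Fin k) E) = a • π h⁻¹ := by
    intro h
    rw [← traceFourier_comp π ψ h⁻¹, ← Units.val_mul, inv_mul_cancel]
    have h1 : traceFourier π ψ ((1 : GL (Fin k) E) : Matrix (Fin k) (Fin k) E) =
        a • (LinearMap.id : V →ₗ[ℂ] V) := by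
      rw [← ha]
      simp [traceFourier]
    rw [h1, LinearMap.smul_comp, LinearMap.id_comp]
  have hmain : q ^ (k * k) • (∑ g ∈ Finset.univ.filter
        (fun g : GL (Fin k) E => (1 + (g : Matrix (Fin k) (Fin k) E)).det ≠ 0), π g) =
      (K * a * b) • (LinearMap.id : V →ₗ[ℂ] V) := by
    calc _ = ∑ g : GL (Fin k) E, (∑ y : Matrix (Fin k) (Fin k) E, ∑ z : GL (Fin k) E,
          ψ ((1 + (g : Matrix (Fin k) (Fin k) E) -
            (z : Matrix (Fin k) (Fin k) E)) * y).trace) • π g := by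
          simp only [hfourier, ite_smul, zero_smul]
          rw [← Finset.sum_filter, Finset.smul_sum]
      _ = ∑ y : Matrix (Fin k) (Fin k) E,
          ((∑ z : GL (Fin k) E, ψ (-((z : Matrix (Fin k) (Fin k) E) * y).trace)) * ψ y.trace) •
            traceFourier π ψ y := by
          simp only [traceFourier, Finset.sum_smul, Finset.smul_sum, Finset.sum_mul]
          rw [Finset.sum_comm]
          refine Finset.sum_congr rfl fun y _ => ?_
          refine Finset.sum_congr rfl fun g _ => ?_
          refine Finset.sum_congr rfl fun z _ => ?_
          rw [smul_smul, ← AddChar.map_add_eq_mul, ← AddChar.map_add_eq_mul]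
          congr 2
          simp only [Matrix.sub_mul, Matrix.add_mul, Matrix.one_mul, Matrix.trace_sub,
            Matrix.trace_add]
          ring
      _ = ∑ h : GL (Fin k) E, (K * ψ (h : Matrix (Fin k) (Fin k) E).trace) • a • π h⁻¹ := by
          symm
          refine Finset.sum_of_injOn (fun h : GL (Fin k) E => (h : Matrix (Fin k) (Fin k) E))
            (fun _ _ _ _ h => Units.ext h) (fun _ _ => Finset.mem_coe.mpr (Finset.mem_univ _))
            ?_ ?_
          · intro y _ hy
            rw [traceFourier_eq_zero π ψ hk hM, smul_zero]
            by_contra hdet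
            exact hy ⟨Matrix.GeneralLinearGroup.mkOfDetNeZero y hdet, by simp, rfl⟩
          · intro h _
            simp only [hneg, hinv]
      _ = (K * a * b) • (LinearMap.id : V →ₗ[ℂ] V) := by
          rw [mul_smul, ← hb, ← Equiv.sum_comp (Equiv.inv (GL (Fin k) E)), Finset.smul_sum]
          refine Finset.sum_congr rfl fun h _ => ?_
          simp only [Equiv.inv_apply, inv_inv, smul_smul]
          congr 1
          ring
  have hexp : k * (k - 1) / 2 + k * (k + 1) / 2 = k * k := by
    obtain ⟨n, rfl⟩ : ∃ n, k = n + 1 := ⟨k - 1, by omega⟩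
    obtain ⟨c, hc⟩ := Nat.even_mul_succ_self n
    have h1 : (n + 1) * (n + 1 - 1) = c + c := by rw [← hc]; simp [mul_comm]
    have h2 : (n + 1) * (n + 1 + 1) = c + c + 2 * (n + 1) := by rw [← hc]; ring
    have h3 : (n + 1) * (n + 1) = c + c + (n + 1) := by rw [← hc]; ring
    omega
  have hqq : q ^ (k * k) ≠ 0 := pow_ne_zero _ hq0
  refine smul_right_injective _ hqq ?_
  simp only
  rw [hmain, smul_smul, hKval, zpow_neg, zpow_natCast, ← hexp, pow_add]
  congr 1
  field_simp
end
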